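/- For all integers m, n, k, j ≥ 0, the q,t-enumerators of doubly decorated reduced polyominoes of size m×n satisfy RP_{q,t}(m,n)^{∗k,j} = RP_{q,t}(m,n)^{∘k,j}, i.e. Σ_{P ∈ RP(m,n)^{∗k,j}} q^{dinv(P)} t^{area(P)} = Σ_{P ∈ RP(m,n)^{∘k,j}} q^{area(P)} t^{bounce(P)}. -/

import Mathlib

open Finset

attribute [local instance] Classical.propDecidable

noncomputable section

/-- The ring of polynomials in the two variables `q` and `t` with integer coefficients. -/
abbrev R2 : Type := MvPolynomial (Fin 2) ℤ

/-- The variable `q`. -/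
def qv : R2 := MvPolynomial.X 0

/-- The variable `t`. -/
def tv : R2 := MvPolynomial.X 1

/-- The Gaussian binomial coefficient `[N choose k]_q`, defined via the q-Pascal
recursion `[N+1, k+1]_q = [N, k]_q + q^(k+1) [N, k+1]_q`; it agrees with
`[N]_q! / ([k]_q! [N-k]_q!)` for `0 ≤ k ≤ N` and vanishes for `k > N`. -/
def qBinom : ℕ → ℕ → R2
  | _, 0 => 1
  | 0, _ + 1 => 0
  | N + 1, k + 1 => qBinom N k + qv ^ (k + 1) * qBinom N (k + 1)

/-- The Gaussian binomial coefficient with integer arguments: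
it is `0` unless `0 ≤ k ≤ N`. -/
def qBinomZ (N k : ℤ) : R2 :=
  if 0 ≤ k ∧ k ≤ N then qBinom N.toNat k.toNat else 0

/-! ## Dyck paths as step words

A lattice path is encoded as a word `w : Fin L → Bool`, where `true` is a north
step and `false` is an east step. -/

/-- The number of north steps among the first `k` steps. -/
def nBef {L : ℕ} (w : Fin L → Bool) (k : ℕ) : ℕ :=
  (univ.filter fun i : Fin L => i.1 < k ∧ w i = true).card

/-- The number of east steps among the first `k` steps. -/
def eBef {L : ℕ} (w : Fin L → Bool) (k : ℕ) : ℕ :=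
  (univ.filter fun i : Fin L => i.1 < k ∧ w i = false).card

/-- `w` is the step word of a Dyck path of size `N`: it has `N` north steps
(hence `N` east steps) and every prefix has at least as many norths as easts,
i.e. the path stays weakly above the main diagonal. -/
def IsDyckStep (N : ℕ) (w : Fin (2 * N) → Bool) : Prop :=
  nBef w (2 * N) = N ∧ ∀ k : ℕ, k ≤ 2 * N → eBef w k ≤ nBef w k

/-- A valley: a north step directly preceded by an east step. -/
def IsValleyS {L : ℕ} (w : Fin L → Bool) (i : Fin L) : Prop :=
  w i = true ∧ ∃ j : Fin L, i.1 = j.1 + 1 ∧ w j = false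

/-- A peak: a north step followed by an east step, or the last (north) step. -/
def IsPeakS {L : ℕ} (w : Fin L → Bool) (i : Fin L) : Prop :=
  w i = true ∧ ∀ j : Fin L, j.1 = i.1 + 1 → w j = false

/-- A fall: an east step immediately followed by another east step. -/
def IsFallS {L : ℕ} (w : Fin L → Bool) (i : Fin L) : Prop :=
  w i = false ∧ ∃ j : Fin L, j.1 = i.1 + 1 ∧ w j = false

/-- A fall, where additionally the last step of the path is allowed. -/
def IsFallX {L : ℕ} (w : Fin L → Bool) (i : Fin L) : Prop :=
  w i = false ∧ (i.1 + 1 = L ∨ ∃ j : Fin L, j.1 = i.1 + 1 ∧ w j = false)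

/-! ## Reduced parallelogram polyominoes: pair-of-paths model

A reduced polyomino of size `m × n` is a pair of lattice paths (red and green,
`true` = north, `false` = east) from `(0,0)` to `(m,n)`, the red one lying
always weakly above the green one. -/

/-- The number of north steps of `w` before its `c`-th east step (for `c` larger
than the number of east steps, this is the total number of north steps). -/
def Yval {L : ℕ} (w : Fin L → Bool) (c : ℕ) : ℕ :=
  (univ.filter fun i : Fin L => w i = true ∧ eBef w i.1 < c).card

/-- The number of east steps of `w` before its `k`-th north step (for `k` larger
than the number of north steps, this is the total number of east steps). -/
def Xval {L : ℕ} (w : Fin L → Bool) (k : ℕ) : ℕ :=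
  (univ.filter fun i : Fin L => w i = false ∧ nBef w i.1 < k).card

/-- `(red, green)` is a pair of paths from `(0,0)` to `(m,n)` with red weakly
above green. -/
def IsRPPair (m n : ℕ) (red green : Fin (m + n) → Bool) : Prop :=
  nBef red (m + n) = n ∧ nBef green (m + n) = n ∧
    ∀ k : ℕ, k ≤ m + n → nBef green k ≤ nBef red k

/-- A green peak: a horizontal green step immediately following a vertical
green step. -/
def IsGreenPeak {L : ℕ} (g : Fin L → Bool) (i : Fin L) : Prop :=
  g i = false ∧ ∃ j : Fin L, i.1 = j.1 + 1 ∧ g j = true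

/-- A red valley: a vertical red step immediately following a horizontal red
step; the first red step counts as a valley if it is vertical. -/
def IsRedValley {L : ℕ} (w : Fin L → Bool) (i : Fin L) : Prop :=
  w i = true ∧ (i.1 = 0 ∨ ∃ j : Fin L, i.1 = j.1 + 1 ∧ w j = false)

/-- Candidate objects: (red path, green path, decorated green peaks,
decorated red valleys). -/
abbrev RPoCand (m n : ℕ) :=
  (Fin (m + n) → Bool) × (Fin (m + n) → Bool) × Finset (Fin (m + n)) × Finset (Fin (m + n))

/-- The `k`-th corner `(p_k, h_k)` of the bounce path of a reduced polyomino: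
starting at `(0,0)` it goes east until the beginning of a vertical green step,
north until the beginning of a horizontal red step, and so on, bouncing at the
beginning of a step of either path. -/
def bncP {L : ℕ} (red green : Fin L → Bool) : ℕ → ℕ × ℕ
  | 0 => (0, 0)
  | k + 1 =>
    let p' := Xval green ((bncP red green k).2 + 1)
    (p', Yval red (p' + 1))

/-- The letter (disregarding the bar) of the bounce word carried by the
vertical bounce step in row `y`. -/
def vLabel {L : ℕ} (red green : Fin L → Bool) (y : ℕ) : ℕ :=
  ((Finset.Icc 1 L).filter fun k => (bncP red green k).2 ≤ y).card

/-- The letter of the bounce word carried by the horizontal bounce step in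
column `c`. -/
def hLabel {L : ℕ} (red green : Fin L → Bool) (c : ℕ) : ℕ :=
  ((Finset.Icc 1 L).filter fun k => (bncP red green k).1 ≤ c).card

/-- The area: the sum of the letters of the area word of the polyomino
disregarding bars, i.e. the number of whole squares lying between the two
paths. -/
def areaRPo {m n : ℕ} (x : RPoCand m n) : ℕ :=
  ∑ c ∈ Finset.Icc 1 m, (Yval x.1 c - Yval x.2.1 c)

/-- The bounce: the sum of the letters of the bounce word disregarding bars,
not counting the barred letters (vertical bounce steps) lying in the same row
as a decorated red valley, nor the unbarred letters (horizontal bounce steps)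
lying in the same column as a decorated green peak. -/
def bounceRPo {m n : ℕ} (x : RPoCand m n) : ℕ :=
  (∑ y ∈ (Finset.range n).filter
      (fun y => y ∉ x.2.2.2.image fun i => nBef x.1 i.1), vLabel x.1 x.2.1 y) +
    ∑ c ∈ (Finset.range m).filter
      (fun c => c ∉ x.2.2.1.image fun i => eBef x.2.1 i.1), hLabel x.1 x.2.1 c

/-- Membership in `RP(m∖r, n)^{∘k, j}`: a reduced polyomino of size `m × n`
with `k` decorated green peaks, `j` decorated red valleys, and exactly `r-1`
letters equal to `0` in the bounce word (the `0` letters of the bounce word are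
the horizontal steps of its initial east run). -/
def IsRPo (m n r k j : ℕ) (x : RPoCand m n) : Prop :=
  IsRPPair m n x.1 x.2.1 ∧
    (∀ i ∈ x.2.2.1, IsGreenPeak x.2.1 i) ∧ x.2.2.1.card = k ∧
    (∀ i ∈ x.2.2.2, IsRedValley x.1 i) ∧ x.2.2.2.card = j ∧
    Xval x.2.1 1 + 1 = r

/-- The `(area, bounce)` q,t-enumerator `RP_{q,t}(m∖r, n)^{∘k, j}`;
it is `0` if some parameter is negative. -/
def RPoE (m n r k j : ℤ) : R2 :=
  if 0 ≤ m ∧ 0 ≤ n ∧ 0 ≤ r ∧ 0 ≤ k ∧ 0 ≤ j then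
    ∑ x ∈ univ.filter (IsRPo m.toNat n.toNat r.toNat k.toNat j.toNat),
      qv ^ areaRPo x * tv ^ bounceRPo x
  else 0

/-! ## Reduced parallelogram polyominoes: area-word model

The letters of the alphabet `0 < 0̄ < 1 < 1̄ < 2 < 2̄ < ⋯` are encoded as
natural numbers: `2v` is the unbarred letter of value `v` and `2v + 1` is the
barred letter of value `v`; the successor in the alphabet is `+1`. -/

/-- Candidate objects: (area word, decorated unbarred rises, decorated barred
rises).  The area word of an `m × n` reduced polyomino has `m + n + 1` letters,
each bounded by its position. -/
abbrev RPCand (m n : ℕ) :=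
  (Fin (m + n + 1) → Fin (2 * (m + n + 1))) ×
    Finset (Fin (m + n + 1)) × Finset (Fin (m + n + 1))

/-- `c` is the area word of an `m × n` reduced polyomino: it starts with the
unbarred letter `0`, whenever a letter is strictly smaller than the next one
the latter is its successor in the alphabet, and it has `m + 1` unbarred
letters and `n` barred letters. -/
def IsRPWord (m n : ℕ) (c : Fin (m + n + 1) → Fin (2 * (m + n + 1))) : Prop :=
  (∀ i, i.1 = 0 → (c i : ℕ) = 0) ∧
    (∀ i j, j.1 = i.1 + 1 → (c j : ℕ) ≤ (c i : ℕ) + 1) ∧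
    (univ.filter fun i => (c i : ℕ) % 2 = 0).card = m + 1 ∧
    (univ.filter fun i => (c i : ℕ) % 2 = 1).card = n

/-- An unbarred rise: an unbarred letter which is the successor (in the
alphabet) of the letter immediately to its left. -/
def IsUnbarredRise {L L' : ℕ} (c : Fin L → Fin L') (i : Fin L) : Prop :=
  (c i : ℕ) % 2 = 0 ∧ ∃ j : Fin L, i.1 = j.1 + 1 ∧ (c i : ℕ) = (c j : ℕ) + 1

/-- A barred rise: a barred letter which is the successor (in the alphabet) of
the letter immediately to its left. -/
def IsBarredRise {L L' : ℕ} (c : Fin L → Fin L') (i : Fin L) : Prop :=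
  (c i : ℕ) % 2 = 1 ∧ ∃ j : Fin L, i.1 = j.1 + 1 ∧ (c i : ℕ) = (c j : ℕ) + 1

/-- Membership in `RP(m∖r, n)^{∗k, j}`: an `m × n` reduced polyomino with `k`
decorated unbarred rises, `j` decorated barred rises, and exactly `r` letters
equal to `0` in its area word (including the initial one). -/
def IsRPstar (m n r k j : ℕ) (x : RPCand m n) : Prop :=
  IsRPWord m n x.1 ∧
    (∀ i ∈ x.2.1, IsUnbarredRise x.1 i) ∧ x.2.1.card = k ∧
    (∀ i ∈ x.2.2, IsBarredRise x.1 i) ∧ x.2.2.card = j ∧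
    (univ.filter fun i => (x.1 i : ℕ) = 0).card = r

/-- The area: the sum of the letters of the area word disregarding bars, not
counting decorated rises of either type. -/
def areaRPstar {m n : ℕ} (x : RPCand m n) : ℕ :=
  ∑ i ∈ univ.filter (fun i => i ∉ x.2.1 ∧ i ∉ x.2.2), (x.1 i : ℕ) / 2

/-- The dinv: the number of pairs `i < j` such that the `i`-th letter of the
area word is the successor, in the alphabet, of the `j`-th letter. -/
def dinvRPstar {m n : ℕ} (x : RPCand m n) : ℕ :=
  (univ.filter fun p : Fin (m + n + 1) × Fin (m + n + 1) =>
    p.1 < p.2 ∧ (x.1 p.1 : ℕ) = (x.1 p.2 : ℕ) + 1).card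

/-- The `(dinv, area)` q,t-enumerator `RP_{q,t}(m∖r, n)^{∗k, j}`;
it is `0` if some parameter is negative. -/
def RPdE (m n r k j : ℤ) : R2 :=
  if 0 ≤ m ∧ 0 ≤ n ∧ 0 ≤ r ∧ 0 ≤ k ∧ 0 ≤ j then
    ∑ x ∈ univ.filter (IsRPstar m.toNat n.toNat r.toNat k.toNat j.toNat),
      qv ^ dinvRPstar x * tv ^ areaRPstar x
  else 0

/-- Membership in `RP(m, n)^{∗k, j}` (no condition on the number of zeroes). -/
def IsRPstarAll (m n k j : ℕ) (x : RPCand m n) : Prop :=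
  IsRPWord m n x.1 ∧
    (∀ i ∈ x.2.1, IsUnbarredRise x.1 i) ∧ x.2.1.card = k ∧
    (∀ i ∈ x.2.2, IsBarredRise x.1 i) ∧ x.2.2.card = j

/-- Membership in `RP(m, n)^{∘k, j}` (no condition on the bounce word). -/
def IsRPoAll (m n k j : ℕ) (x : RPoCand m n) : Prop :=
  IsRPPair m n x.1 x.2.1 ∧
    (∀ i ∈ x.2.2.1, IsGreenPeak x.2.1 i) ∧ x.2.2.1.card = k ∧
    (∀ i ∈ x.2.2.2, IsRedValley x.1 i) ∧ x.2.2.2.card = j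

/-- The subword of `w` of the nonzero letters, each lowered by one. -/
def lowerWord (w : List ℕ) : List ℕ := (w.filter (fun x => x != 0)).map (fun x => x - 1)

/-- The bits of the letters `< 2 * K` of `w`, stably sorted by `(x + s) / 2`: `true` for a barred
(odd) letter, `false` for an unbarred (even) one. -/
def sortBits (s K : ℕ) (w : List ℕ) : List Bool :=
  ((List.range K).flatMap fun v => w.filter fun x => (x + s) / 2 == v).map fun x => x % 2 == 1

/-- Area words: the first letter, if any, is `0`, and letters rise by at most one. -/
def IsAreaWord (w : List ℕ) : Prop :=
  (∀ x, w.head? = some x → x = 0) ∧ w.IsChain fun a b => b ≤ a + 1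

theorem lowerWord_cons (x : ℕ) (w : List ℕ) :
    lowerWord (x :: w) = if x = 0 then lowerWord w else (x - 1) :: lowerWord w := by
  by_cases h : x = 0 <;> simp [lowerWord, h]

theorem sortBits_zero_succ (K : ℕ) (w : List ℕ) :
    sortBits 0 (K + 1) w =
      ((w.filter fun x => x < 2).map fun x => x % 2 == 1) ++
        sortBits 0 K (lowerWord (lowerWord w)) := by
  unfold sortBits
  rw [List.range_succ_eq_map, List.flatMap_cons, List.map_append]
  congr 1
  · congr 1
    apply List.filter_congr
    intro x _
    rw [Bool.eq_iff_iff]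
    simp
  · rw [List.flatMap_map, List.map_flatMap, List.map_flatMap]
    congr 1
    funext v
    simp only [lowerWord, List.filter_map, List.map_map, List.filter_filter]
    have : (w.filter fun x => (x + 0) / 2 == v.succ) = w.filter fun x =>
        ((x - 1 - 1 + 0) / 2 == v && (x - 1 != 0 && x != 0)) := by
      apply List.filter_congr
      intro x _
      rw [Bool.eq_iff_iff]
      simp
      omega
    rw [this]
    refine (List.map_congr_left fun x hx => ?_).trans rfl
    simp only [List.mem_filter, Bool.and_eq_true, bne_iff_ne] at hx
    rw [Bool.eq_iff_iff]
    simp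
    omega

theorem sortBits_one_succ (K : ℕ) (w : List ℕ) :
    sortBits 1 (K + 1) w =
      List.replicate (w.count 0) false ++ (sortBits 0 K (lowerWord w)).map not := by
  unfold sortBits
  rw [List.range_succ_eq_map, List.flatMap_cons, List.map_append]
  congr 1
  · have : (w.filter fun x => (x + 1) / 2 == 0) = w.filter fun x => x == 0 := by
      apply List.filter_congr
      intro x _
      rw [Bool.eq_iff_iff]
      simp
    rw [this, List.filter_beq]
    simp
  · rw [List.flatMap_map, List.map_flatMap, List.map_flatMap, List.map_flatMap]
    congr 1
    funext v
    simp only [lowerWord, List.filter_map, List.map_map, List.filter_filter]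
    have : (w.filter fun x => (x + 1) / 2 == v.succ) = w.filter fun x =>
        ((x - 1 + 0) / 2 == v && x != 0) := by
      apply List.filter_congr
      intro x _
      rw [Bool.eq_iff_iff]
      simp
      omega
    rw [this]
    refine (List.map_congr_left fun x hx => ?_).trans rfl
    simp only [List.mem_filter, Bool.and_eq_true, bne_iff_ne] at hx
    rw [Bool.eq_iff_iff]
    simp
    omega

theorem sortBits_succ_of_lt {s K : ℕ} {w : List ℕ} (h : ∀ x ∈ w, (x + s) / 2 < K) :
    sortBits s (K + 1) w = sortBits s K w := by
  have : (w.filter fun x => (x + s) / 2 == K) = [] := by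
    rw [List.filter_eq_nil_iff]
    intro x hx
    have := h x hx
    simp
    omega
  simp [sortBits, List.range_succ, this]

theorem count_false_filter_lt_two (w : List ℕ) :
    ((w.filter fun x => x < 2).map fun x => x % 2 == 1).count false = w.count 0 := by
  induction w with
  | nil => simp
  | cons x w ih =>
    rcases x with _ | _ | x <;> simp_all

theorem count_true_filter_lt_two (w : List ℕ) :
    ((w.filter fun x => x < 2).map fun x => x % 2 == 1).count true = (lowerWord w).count 0 := by
  induction w with
  | nil => simp [lowerWord]
  | cons x w ih =>
    rw [lowerWord_cons]
    rcases x with _ | _ | x <;> simp_all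

theorem isChain_lowerWord (w : List ℕ) (h : w.IsChain fun a b => b ≤ a + 1) :
    (lowerWord w).IsChain (fun a b => b ≤ a + 1) ∧
      ∀ x y, w.head? = some x → (lowerWord w).head? = some y → y ≤ x - 1 := by
  induction w with
  | nil => simp [lowerWord]
  | cons x w ih =>
    rcases w with _ | ⟨z, w⟩
    · rw [lowerWord_cons]
      split_ifs <;> simp [lowerWord]
      omega
    · obtain ⟨hz, hc⟩ := List.isChain_cons_cons.1 h
      obtain ⟨ih1, ih2⟩ := ih hc
      rw [lowerWord_cons]
      split_ifs with hx
      · refine ⟨ih1, fun x' y hx' hy => ?_⟩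
        have := ih2 z y rfl hy
        simp at hx'
        omega
      · refine ⟨List.isChain_cons.2 ⟨fun y hy => ?_, ih1⟩, fun x' y hx' hy => ?_⟩
        · have := ih2 z y rfl hy
          omega
        · simp at hx' hy
          omega

theorem IsAreaWord.lowerWord {w : List ℕ} (h : IsAreaWord w) : IsAreaWord (lowerWord w) := by
  obtain ⟨h1, h2⟩ := isChain_lowerWord w h.2
  refine ⟨fun y hy => ?_, h1⟩
  rcases w with _ | ⟨x, w⟩
  · simp [_root_.lowerWord] at hy
  · have := h2 x y rfl hy
    have := h.1 x rfl
    omega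

theorem head_sortBits_zero {w : List ℕ} (h : IsAreaWord w) (K : ℕ) :
    (sortBits 0 K w).head? ≠ some true := by
  induction K generalizing w with
  | zero => simp [sortBits]
  | succ K ih =>
    rw [sortBits_zero_succ]
    rcases w with _ | ⟨x, w⟩
    · simpa using ih h.lowerWord.lowerWord
    · obtain rfl := h.1 x rfl
      simp

theorem append_replicate_false_cancel {c c' : ℕ} {X X' : List Bool}
    (hX : X.head? ≠ some false) (hX' : X'.head? ≠ some false)
    (h : List.replicate c false ++ X = List.replicate c' false ++ X') : c = c' ∧ X = X' := by
  induction c generalizing c' with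
  | zero =>
    rcases c' with _ | c'
    · simpa using h
    · simp at h; subst h; simp [List.replicate_succ] at hX
  | succ c ih =>
    rcases c' with _ | c'
    · simp at h; subst h; simp [List.replicate_succ] at hX'
    · simp only [List.replicate_succ, List.cons_append, List.cons.injEq, true_and] at h
      have := ih h
      simpa using this

theorem append_cancel_of_count_false {s s' X X' : List Bool}
    (hs : s.count false = s'.count false) (hX : X.head? ≠ some true) (hX' : X'.head? ≠ some true)
    (h : s ++ X = s' ++ X') : s = s' ∧ X = X' := by
  induction s generalizing s' with
  | nil =>
    rcases s' with _ | ⟨b, s'⟩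
    · simpa using h
    · rcases b <;> simp_all
  | cons a s ih =>
    rcases s' with _ | ⟨b, s'⟩
    · rcases a <;> simp_all
      simp [← h] at hX'
    · simp only [List.cons_append, List.cons.injEq] at h
      obtain ⟨rfl, h⟩ := h
      have := ih (s' := s') (by rcases a <;> simp_all) h
      simp [this]

theorem eq_of_lowerWord_eq {w w' : List ℕ} (hw : IsAreaWord w) (hw' : IsAreaWord w')
    (hl : lowerWord w = lowerWord w')
    (hf : ((w.filter fun x => x < 2).map fun x => x % 2 == 1) =
      (w'.filter fun x => x < 2).map fun x => x % 2 == 1) : w = w' := by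
  have key : ∀ w w' : List ℕ, w.IsChain (fun a b => b ≤ a + 1) →
      w'.IsChain (fun a b => b ≤ a + 1) → lowerWord w = lowerWord w' →
      ((w.filter fun x => x < 2).map fun x => x % 2 == 1) =
        ((w'.filter fun x => x < 2).map fun x => x % 2 == 1) → w = w' := by
    intro w
    induction w with
    | nil =>
      intro w' _ _ hl hf
      rcases w' with _ | ⟨y, w'⟩
      · rfl
      · rcases y with _ | y <;> simp [lowerWord] at hl hf
    | cons x w ih =>
      intro w' hc hc' hl hf
      rcases w' with _ | ⟨y, w'⟩
      · rcases x with _ | x <;> simp [lowerWord] at hl hf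
      · rw [lowerWord_cons, lowerWord_cons] at hl
        have hxy : x = y := by
          have h1 := (isChain_lowerWord _ hc).2 x
          have h2 := (isChain_lowerWord _ hc').2 y
          simp only [lowerWord_cons, List.head?_cons, forall_const] at h1 h2
          rcases x with _ | _ | x <;> rcases y with _ | _ | y <;>
            simp_all
          simp [← hl] at h2
        subst hxy
        congr 1
        refine ih w' hc.tail hc'.tail ?_ ?_
        · split_ifs at hl
          · exact hl
          · exact (List.cons.inj hl).2
        · rw [List.filter_cons, List.filter_cons] at hf
          split_ifs at hf
          · exact (List.cons.inj hf).2
          · exact hf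
  exact key w w' hw.2 hw'.2 hl hf

theorem lt_of_mem_lowerWord {K : ℕ} {v : List ℕ} (hv : ∀ x ∈ v, x < K + 1) :
    ∀ x ∈ lowerWord v, x < K := by
  intro x hx
  simp only [lowerWord, List.mem_map, List.mem_filter, bne_iff_ne] at hx
  obtain ⟨y, hy, rfl⟩ := hx
  have := hv y hy.1
  omega

theorem areaWord_ext {K : ℕ} {w w' : List ℕ} (hw : IsAreaWord w) (hw' : IsAreaWord w')
    (hK : ∀ x ∈ w, x < K) (hK' : ∀ x ∈ w', x < K)
    (h0 : sortBits 0 K w = sortBits 0 K w') (h1 : sortBits 1 K w = sortBits 1 K w') : w = w' := by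
  induction K generalizing w w' with
  | zero =>
    rw [List.eq_nil_iff_forall_not_mem.2 fun x hx => absurd (hK x hx) (by omega),
      List.eq_nil_iff_forall_not_mem.2 fun x hx => absurd (hK' x hx) (by omega)]
  | succ K ih =>
    have hnot : ∀ {v : List ℕ}, IsAreaWord v → ((sortBits 0 K v).map not).head? ≠ some false := by
      intro v hv
      have := head_sortBits_zero hv K
      simpa using this
    rw [sortBits_one_succ, sortBits_one_succ] at h1
    rw [sortBits_zero_succ, sortBits_zero_succ] at h0
    obtain ⟨hc, h1⟩ := append_replicate_false_cancel (hnot hw.lowerWord) (hnot hw'.lowerWord) h1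
    obtain ⟨hs, h0⟩ := append_cancel_of_count_false
      (by rw [count_false_filter_lt_two, count_false_filter_lt_two, hc])
      (head_sortBits_zero hw.lowerWord.lowerWord K)
      (head_sortBits_zero hw'.lowerWord.lowerWord K) h0
    have h1 := List.map_injective_iff.2 Bool.not_injective h1
    refine eq_of_lowerWord_eq hw hw' (ih hw.lowerWord hw'.lowerWord
      (lt_of_mem_lowerWord hK) (lt_of_mem_lowerWord hK') h1 ?_) hs
    have hlt : ∀ {v : List ℕ}, (∀ x ∈ v, x < K) → ∀ x ∈ v, (x + 1) / 2 < K := by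
      intro v hv x hx
      have := hv x hx
      omega
    rw [← sortBits_succ_of_lt (hlt (lt_of_mem_lowerWord hK)),
      ← sortBits_succ_of_lt (hlt (lt_of_mem_lowerWord hK')),
      sortBits_one_succ, sortBits_one_succ, h0, ← count_true_filter_lt_two, hs,
      count_true_filter_lt_two]

theorem exists_lowerWord_eq (s : List Bool) (v : List ℕ) (hv : v.IsChain fun a b => b ≤ a + 1)
    (hc : s.count true = v.count 0) :
    ∃ w : List ℕ, w.IsChain (fun a b => b ≤ a + 1) ∧ lowerWord w = v ∧
      ((w.filter fun x => x < 2).map fun x => x % 2 == 1) = s ∧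
      w.length = s.count false + v.length ∧
      (∀ y, w.head? = some y → y ≤ v.headD 0 + 1) ∧
      (v.headD 0 = 0 → s.head? = some false → w.head? = some 0) := by
  induction hn : s.length + v.length using Nat.strong_induction_on generalizing s v with
  | _ n ih =>
  have cons_false : v.headD 0 = 0 → ∀ s', s = false :: s' →
      ∃ w : List ℕ, w.IsChain (fun a b => b ≤ a + 1) ∧ lowerWord w = v ∧
        ((w.filter fun x => x < 2).map fun x => x % 2 == 1) = s ∧
        w.length = s.count false + v.length ∧
        (∀ y, w.head? = some y → y ≤ v.headD 0 + 1) ∧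
        (v.headD 0 = 0 → s.head? = some false → w.head? = some 0) := by
    rintro h0 s' rfl
    obtain ⟨w, h1, h2, h3, h4, h5, h6⟩ :=
      ih _ (by simp at hn; omega) s' v hv (by simpa using hc) rfl
    refine ⟨0 :: w, List.isChain_cons.2 ⟨fun y hy => ?_, h1⟩, ?_, ?_, ?_, ?_, ?_⟩
    · have := h5 y hy
      omega
    · simpa [lowerWord_cons] using h2
    · rw [List.filter_cons]; simp [← h3]
    · simp [h4]; omega
    · simp
    · simp
  rcases v with _ | ⟨x, v⟩
  · rcases s with _ | ⟨b, s⟩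
    · exact ⟨[], by simp [lowerWord]⟩
    · rcases b
      · exact cons_false rfl s rfl
      · simp at hc
  · have hv' := List.isChain_cons.1 hv
    have hh : v.headD 0 ≤ x + 1 := by
      rcases v with _ | ⟨z, v⟩
      · simp
      · exact hv'.1 z rfl
    rcases x with _ | x
    · rcases s with _ | ⟨b, s⟩
      · simp at hc
      · rcases b
        · exact cons_false rfl s rfl
        · obtain ⟨w, h1, h2, h3, h4, h5, h6⟩ :=
            ih _ (by simp at hn; omega) s v hv'.2 (by simpa using hc) rfl
          refine ⟨1 :: w, List.isChain_cons.2 ⟨fun y hy => ?_, h1⟩, ?_, ?_, ?_, ?_, ?_⟩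
          · have := h5 y hy
            omega
          · simpa [lowerWord_cons] using h2
          · rw [List.filter_cons]; simp [← h3]
          · simp [h4]; omega
          · simp
          · simp
    · obtain ⟨w, h1, h2, h3, h4, h5, h6⟩ :=
        ih _ (by simp at hn; omega) s v hv'.2 (by simpa using hc) rfl
      refine ⟨(x + 2) :: w, List.isChain_cons.2 ⟨fun y hy => ?_, h1⟩, ?_, ?_, ?_, ?_, ?_⟩
      · have := h5 y hy
        omega
      · simpa [lowerWord_cons] using h2
      · rw [List.filter_cons]; simp [← h3]
      · simp [h4]; omega
      · simp
      · simp

theorem exists_eq_replicate_false_append (G : List Bool) :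
    ∃ c G', G = List.replicate c false ++ G' ∧ G'.head? ≠ some false := by
  induction G with
  | nil => exact ⟨0, [], by simp⟩
  | cons b G ih =>
    rcases b
    · obtain ⟨c, G', h, h'⟩ := ih
      exact ⟨c + 1, G', by simp [h, List.replicate_succ], h'⟩
    · exact ⟨0, true :: G, by simp⟩

theorem exists_eq_append_count_false (c : ℕ) (R : List Bool) (h : c ≤ R.count false) :
    ∃ s R', R = s ++ R' ∧ s.count false = c ∧ R'.head? ≠ some true := by
  induction R generalizing c with
  | nil => exact ⟨[], [], by simp at h; simp [h]⟩
  | cons b R ih =>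
    rcases b
    · rcases c with _ | c
      · exact ⟨[], false :: R, by simp⟩
      · obtain ⟨s, R', h1, h2, h3⟩ := ih c (by simpa using h)
        exact ⟨false :: s, R', by simp [h1], by simp [h2], h3⟩
    · obtain ⟨s, R', h1, h2, h3⟩ := ih c (by simpa using h)
      exact ⟨true :: s, R', by simp [h1], by simp [h2], h3⟩

theorem count_false_add_count_true (l : List Bool) : l.count false + l.count true = l.length := by
  induction l with
  | nil => rfl
  | cons b l ih => rcases b <;> simp <;> omega

theorem count_map_not (l : List Bool) (b : Bool) : (l.map not).count b = l.count (!b) := by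
  induction l with
  | nil => rfl
  | cons a l ih => rcases a <;> rcases b <;> simp_all

/-- Every pair of bit words, both starting with `false`, with the first one weakly above the second
one, comes from an area word by sorting. -/
theorem exists_areaWord (R G : List Bool) (hlen : R.length = G.length)
    (hcount : R.count true = G.count true)
    (habove : ∀ k, (G.take k).count true ≤ (R.take k).count true)
    (hR : R.head? = some false) (hG : G.head? = some false) :
    ∃ w : List ℕ, IsAreaWord w ∧ w.length = R.length ∧
      ∀ K, (∀ x ∈ w, x < K) → sortBits 0 K w = R ∧ sortBits 1 K w = G := by
  induction hn : R.length using Nat.strong_induction_on generalizing R G with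
  | _ n ih =>
  obtain ⟨c, G₁, rfl, hG₁⟩ := exists_eq_replicate_false_append G
  have hcf := count_false_add_count_true R
  have hcf' := count_false_add_count_true (List.replicate c false ++ G₁)
  simp only [List.count_append, List.count_replicate_self, List.length_append,
    List.length_replicate] at hcf' hlen hcount
  obtain ⟨s, R₁, rfl, hs, hR₁⟩ := exists_eq_append_count_false c R (by omega)
  have hss := count_false_add_count_true s
  have hct : (List.replicate c false).count true = 0 := by rw [List.count_replicate]; rfl
  have hc0 : 0 < c := by
    rcases c with _ | c
    · simp [hG₁] at hG
    · omega
  set b := s.count true with hb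
  have hsf : s.head? = some false := by
    rcases s with _ | ⟨a, s⟩
    · simp at hs; omega
    · simpa using hR
  have hlenG := count_false_add_count_true G₁
  have hlenR := count_false_add_count_true R₁
  simp only [List.count_append, List.length_append] at hcf hcount hlen hn
  have hR₁n : (R₁.map not).head? ≠ some false := by simpa using hR₁
  obtain ⟨v, hv, hvl, hvK⟩ : ∃ v : List ℕ, IsAreaWord v ∧ v.length = G₁.length ∧
      ∀ K, (∀ x ∈ v, x < K) →
        sortBits 0 K v = G₁.map not ∧ sortBits 1 K v = List.replicate b false ++ R₁.map not := by
    rcases hG₁e : G₁ with _ | ⟨a, G₂⟩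
    · subst hG₁e
      simp only [List.count_nil, List.length_nil] at *
      have hR₁0 : R₁ = [] := List.length_eq_zero_iff.1 (by omega)
      have hb0 : b = 0 := by omega
      exact ⟨[], by simp [IsAreaWord], rfl, fun K _ => by simp [sortBits, hR₁0, hb0]⟩
    · obtain rfl : a = true := by
        subst hG₁e
        rcases a <;> simp_all
      rw [← hG₁e]
      have hb0 : 0 < b := by
        by_contra hb0
        have h := habove (c + 1)
        rw [List.take_append, List.take_append, List.take_of_length_le (by simp),
          List.take_of_length_le (by omega : s.length ≤ c + 1),
          show c + 1 - s.length = 1 by omega, List.length_replicate, Nat.add_sub_cancel_left,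
          List.count_append, List.count_append, ← hb] at h
        have e1 : (G₁.take 1).count true = 1 := by simp [hG₁e]
        have e2 : (R₁.take 1).count true = 0 := by
          rcases R₁ with _ | ⟨_ | _, R₂⟩
          · rfl
          · rfl
          · simp at hR₁
        omega
      have hlt : G₁.length < n := by omega
      have := ih G₁.length hlt (G₁.map not)
        (List.replicate b false ++ R₁.map not) (by simp; omega)
        (by
          simp only [count_map_not, List.count_append, Bool.not_true]
          simp only [List.count_replicate]
          simp
          omega)
        (fun k => by
          rw [← List.map_take, count_map_not, List.take_append, List.count_append,
            ← List.map_take, count_map_not]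
          simp only [List.take_replicate, List.length_replicate, Bool.not_true]
          have h := habove (c + k)
          rw [List.take_append, List.take_append, List.take_of_length_le (by simp)] at h
          simp only [List.count_append, List.length_replicate, add_tsub_cancel_left] at h
          have e1 := count_false_add_count_true (G₁.take k)
          have e2 := count_false_add_count_true (R₁.take (k - b))
          rcases le_total k b with hk | hk
          · simp [Nat.sub_eq_zero_of_le hk, List.count_replicate]
          · rw [List.take_of_length_le (by omega : s.length ≤ c + k),
              show c + k - s.length = k - b by omega] at h
            simp only [List.count_replicate, List.length_take] at h e1 e2 ⊢
            simp at h ⊢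
            omega)
        (by simp [hG₁e]) (by
          obtain ⟨b', hb'⟩ := Nat.exists_eq_succ_of_ne_zero hb0.ne'
          simp [hb', List.replicate_succ]) (by simp)
      simpa using this
  have hvb : ∀ K, (∀ x ∈ v, x < K) → v.count 0 = b ∧ sortBits 0 K (lowerWord v) = R₁ := by
    intro K hK
    have h1 := (hvK (K + 1) fun x hx => (hK x hx).trans K.lt_succ_self).2
    rw [sortBits_one_succ] at h1
    have := append_replicate_false_cancel
      (by simpa using head_sortBits_zero hv.lowerWord K) hR₁n h1
    exact ⟨this.1, List.map_injective_iff.2 Bool.not_injective this.2⟩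
  have hv0 : v.headD 0 = 0 := by
    rcases v with _ | ⟨x, v⟩
    · rfl
    · exact hv.1 x rfl
  obtain ⟨M, hM⟩ := v.toFinset.exists_nat_subset_range
  obtain ⟨w, w1, w2, w3, w4, w5, w6⟩ := exists_lowerWord_eq s v hv.2
    (hvb M fun x hx => by simpa using hM (List.mem_toFinset.2 hx)).1.symm
  have hw : IsAreaWord w := ⟨fun x hx => by simpa [w6 hv0 hsf, eq_comm] using hx, w1⟩
  refine ⟨w, hw, by omega, fun K hK => ?_⟩
  rcases K with _ | K
  · exact absurd (hK 0 (List.mem_of_head? (w6 hv0 hsf))) (by omega)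
  · have : ∀ x ∈ v, x < K := w2 ▸ lt_of_mem_lowerWord hK
    rw [sortBits_zero_succ, sortBits_one_succ, w3, w2, (hvb K this).2, (hvK K this).1,
      ← count_false_filter_lt_two, w3, hs]
    simp [Function.comp_def]

/-- `i` comes strictly before `j` when the positions of the word `c` are stably sorted
by `(c i + s) / 2`. -/
def SortLT (s : ℕ) {n : ℕ} (c : Fin n → ℕ) (i j : Fin n) : Prop :=
  (c i + s) / 2 < (c j + s) / 2 ∨ ((c i + s) / 2 = (c j + s) / 2 ∧ i < j)

/-- `e` lists the positions of `c` in the order `SortLT s c`. -/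
def IsSorting (s : ℕ) {n : ℕ} (c : Fin n → ℕ) (e : Fin n ≃ Fin n) : Prop :=
  ∀ a b, a < b ↔ SortLT s c (e a) (e b)

theorem SortLT.asymm {s n : ℕ} {c : Fin n → ℕ} {i j : Fin n} (h : SortLT s c i j) :
    ¬ SortLT s c j i := by
  unfold SortLT at *
  omega

theorem exists_isSorting (s K : ℕ) {n : ℕ} (c : Fin n → ℕ) (hK : ∀ i, (c i + s) / 2 < K) :
    ∃ e : Fin n ≃ Fin n, IsSorting s c e ∧
      sortBits s K (List.ofFn c) = List.ofFn fun a => c (e a) % 2 == 1 := by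
  set l : List (Fin n) :=
    (List.range K).flatMap fun v => (List.finRange n).filter fun i => (c i + s) / 2 == v with hl
  have hmap : sortBits s K (List.ofFn c) = l.map fun i => c i % 2 == 1 := by
    simp only [sortBits, hl, List.ofFn_eq_map, List.filter_map, List.map_flatMap, List.map_map,
      Function.comp_def]
  have hpw : l.Pairwise (SortLT s c) := by
    rw [hl, List.pairwise_flatMap]
    refine ⟨fun v _ => ?_, ?_⟩
    · rw [List.pairwise_filter]
      refine (List.pairwise_lt_finRange n).imp fun {i j} hij hi hj => ?_
      simp only [beq_iff_eq] at hi hj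
      exact Or.inr ⟨hi.trans hj.symm, hij⟩
    · refine List.pairwise_lt_range.imp fun {u v} huv i hi j hj => ?_
      simp only [List.mem_filter, beq_iff_eq] at hi hj
      exact Or.inl (by omega)
  have hmem : ∀ i, i ∈ l := by
    intro i
    simp [hl, hK i]
  have hnd : l.Nodup := hpw.imp fun {i j} h hij => by
    subst hij
    exact h.asymm h
  have hlen : l.length = n := by
    rw [← List.toFinset_card_of_nodup hnd,
      Finset.eq_univ_of_forall fun i => List.mem_toFinset.2 (hmem i)]
    simp
  let e : Fin n ≃ Fin n := (finCongr hlen.symm).trans (hnd.getEquivOfForallMemList l hmem)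
  have he : ∀ a, e a = l[a.1]'(by omega) := fun a => rfl
  have hlt : ∀ a b, a < b → SortLT s c (e a) (e b) := by
    intro a b hab
    exact List.pairwise_iff_getElem.1 hpw a b _ _ hab
  refine ⟨e, fun a b => ⟨hlt a b, fun h => ?_⟩, ?_⟩
  · rcases lt_trichotomy a b with h' | rfl | h'
    · exact h'
    · exact absurd h h.asymm
    · exact absurd h (hlt b a h').asymm
  · rw [hmap]
    apply List.ext_getElem
    · simp [hlen]
    · intro i h1 h2
      simp [he]

/-- The step word read off the positions of `c` in the order `e`, the first one being dropped:
barred letters are north steps. -/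
def sortPath {N : ℕ} (c : Fin (N + 1) → ℕ) (e : Fin (N + 1) ≃ Fin (N + 1)) : Fin N → Bool :=
  fun k => c (e k.succ) % 2 == 1

/-- The conditions on an area word: it starts with `0` and rises by at most one. -/
structure IsAreaFun {N : ℕ} (c : Fin (N + 1) → ℕ) : Prop where
  zero : c 0 = 0
  step : ∀ i j : Fin (N + 1), j.1 = i.1 + 1 → c j ≤ c i + 1

theorem IsAreaFun.le {N : ℕ} {c : Fin (N + 1) → ℕ} (hc : IsAreaFun c) (i : Fin (N + 1)) :
    c i ≤ i := by
  obtain ⟨i, hi⟩ := i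
  induction i with
  | zero => exact hc.zero.le
  | succ i ih =>
    have := hc.step ⟨i, by omega⟩ ⟨i + 1, hi⟩ rfl
    have := ih (by omega)
    simp only at *
    omega

theorem IsAreaFun.exists_eq {N : ℕ} {c : Fin (N + 1) → ℕ} (hc : IsAreaFun c)
    {a b : Fin (N + 1)} {v : ℕ} (hab : a ≤ b) (ha : c a ≤ v) (hb : v ≤ c b) :
    ∃ x, a ≤ x ∧ x ≤ b ∧ c x = v := by
  obtain ⟨b, hb'⟩ := b
  induction b with
  | zero =>
    have ha0 : a = ⟨0, hb'⟩ := le_antisymm hab (Nat.zero_le _)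
    exact ⟨a, le_rfl, hab, ha.antisymm (by rwa [ha0])⟩
  | succ b ih =>
    rcases hb.eq_or_lt with h | h
    · exact ⟨_, hab, le_rfl, h.symm⟩
    · have h1 := hc.step ⟨b, by omega⟩ ⟨b + 1, hb'⟩ rfl
      rcases hab.eq_or_lt with rfl | hab
      · omega
      · obtain ⟨x, h2, h3, h4⟩ := ih (by omega)
          (Fin.le_def.2 (by have := Fin.lt_def.1 hab; simp at this ⊢; omega)) (by omega)
        exact ⟨x, h2, h3.trans (Fin.le_def.2 (by simp)), h4⟩

theorem IsAreaFun.exists_lt {N : ℕ} {c : Fin (N + 1) → ℕ} (hc : IsAreaFun c)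
    {b : Fin (N + 1)} {v : ℕ} (hb : v < c b) : ∃ x, x < b ∧ c x = v := by
  obtain ⟨x, -, h2, h3⟩ := hc.exists_eq (Fin.zero_le b) (by simp [hc.zero]) hb.le
  refine ⟨x, lt_of_le_of_ne h2 ?_, h3⟩
  rintro rfl
  omega

section Sorting

variable {N s : ℕ} {c : Fin (N + 1) → ℕ} {e : Fin (N + 1) ≃ Fin (N + 1)}

theorem IsSorting.apply_zero (hc : IsAreaFun c) (he : IsSorting s c e) : e 0 = 0 := by
  by_contra h
  have h1 : SortLT s c 0 (e 0) := by
    unfold SortLT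
    rw [hc.zero]
    have : (0 : Fin (N + 1)) < e 0 := Fin.pos_of_ne_zero h
    omega
  have h2 := (he (e.symm 0) 0).2 (by simpa using h1)
  simp at h2

theorem IsSorting.apply_succ_ne_zero (hc : IsAreaFun c) (he : IsSorting s c e)
    (k : Fin N) : e k.succ ≠ 0 := by
  rw [← he.apply_zero hc]
  exact fun h => Fin.succ_ne_zero k (e.injective h)

theorem IsSorting.exists_apply_succ (hc : IsAreaFun c) (he : IsSorting s c e)
    {i : Fin (N + 1)} (hi : i ≠ 0) : ∃ k : Fin N, e k.succ = i := by
  obtain ⟨k, hk⟩ := Fin.exists_succ_eq.2 (show e.symm i ≠ 0 by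
    rw [ne_eq, Equiv.symm_apply_eq, he.apply_zero hc]
    exact hi)
  exact ⟨k, by rw [hk, Equiv.apply_symm_apply]⟩

theorem IsSorting.sum_filter (hc : IsAreaFun c) (he : IsSorting s c e)
    (P : Fin (N + 1) → Prop) (F : Fin (N + 1) → ℕ) [DecidablePred fun k : Fin N => P (e k.succ)]
    [DecidablePred fun i => i ≠ 0 ∧ P i] :
    ∑ k : Fin N with P (e k.succ), F (e k.succ) = ∑ i with i ≠ 0 ∧ P i, F i := by
  refine Finset.sum_bij (fun k _ => e k.succ) ?_ ?_ ?_ ?_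
  · intro k hk
    simp only [mem_filter, mem_univ, true_and] at hk ⊢
    exact ⟨he.apply_succ_ne_zero hc k, hk⟩
  · intro k _ l _ h
    exact Fin.succ_injective _ (e.injective h)
  · intro i hi
    simp only [mem_filter, mem_univ, true_and] at hi
    obtain ⟨k, rfl⟩ := he.exists_apply_succ hc hi.1
    exact ⟨k, by simpa using hi.2, rfl⟩
  · intros
    rfl

theorem IsSorting.card_filter (hc : IsAreaFun c) (he : IsSorting s c e)
    (P : Fin (N + 1) → Prop) [DecidablePred fun k : Fin N => P (e k.succ)]
    [DecidablePred fun i => i ≠ 0 ∧ P i] :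
    #{k : Fin N | P (e k.succ)} = #{i | i ≠ 0 ∧ P i} := by
  rw [card_eq_sum_ones, card_eq_sum_ones]
  exact he.sum_filter hc P fun _ => 1

/-- The number of noninitial positions of parity `b` that are sorted before `j`. -/
def sortRank (s : ℕ) (c : Fin (N + 1) → ℕ) (b : Bool) (j : Fin (N + 1)) : ℕ :=
  #{i | i ≠ 0 ∧ SortLT s c i j ∧ (c i % 2 == 1) = b}

theorem IsSorting.card_lt (hc : IsAreaFun c) (he : IsSorting s c e) (b : Bool)
    (k : Fin N) :
    #{l : Fin N | l.1 < k.1 ∧ sortPath c e l = b} = sortRank s c b (e k.succ) := by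
  refine Eq.trans ?_ (he.card_filter hc fun i => SortLT s c i (e k.succ) ∧ (c i % 2 == 1) = b)
  congr 1
  ext l
  rw [mem_filter, mem_filter, ← he, Fin.succ_lt_succ_iff]
  rfl

theorem IsSorting.nBef_sortPath (hc : IsAreaFun c) (he : IsSorting s c e)
    (k : Fin N) : nBef (sortPath c e) k = sortRank s c true (e k.succ) :=
  he.card_lt hc true k

theorem IsSorting.eBef_sortPath (hc : IsAreaFun c) (he : IsSorting s c e)
    (k : Fin N) : eBef (sortPath c e) k = sortRank s c false (e k.succ) :=
  he.card_lt hc false k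

/-- The number of noninitial letters of parity `b` that are smaller than `2 * k`. -/
def cntBelow (c : Fin (N + 1) → ℕ) (b : Bool) (k : ℕ) : ℕ :=
  #{i | i ≠ 0 ∧ (c i % 2 == 1) = b ∧ c i < 2 * k}

theorem cntBelow_le_sortRank {i : Fin (N + 1)} {b : Bool} (hi : i ≠ 0)
    (hb : (c i % 2 == 1) = b) (k : ℕ) : cntBelow c b k ≤ sortRank s c b i ↔ 2 * k ≤ c i := by
  have aux : ∀ j, (c j % 2 == 1) = b → c j % 2 = c i % 2 := by
    intro j hj
    rw [← hb, Bool.eq_iff_iff] at hj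
    simp at hj
    omega
  constructor
  · intro h
    by_contra hk
    refine absurd h (not_le.2 (card_lt_card ?_))
    rw [ssubset_iff_of_subset]
    · refine ⟨i, by simp; exact ⟨hi, hb, by omega⟩, fun h' => ?_⟩
      simp only [mem_filter, mem_univ, true_and] at h'
      exact h'.2.1.asymm h'.2.1
    · intro j
      simp only [mem_filter, mem_univ, true_and]
      unfold SortLT
      rintro ⟨h1, h2, h3⟩
      have := aux j h3
      exact ⟨h1, h3, by omega⟩
  · intro h
    refine card_le_card fun j => ?_
    simp only [mem_filter, mem_univ, true_and]
    unfold SortLT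
    rintro ⟨h1, h2, h3⟩
    have := aux j h2
    exact ⟨h1, by omega, h2⟩

theorem sortRank_one_true_le (hc : IsAreaFun c) {i : Fin (N + 1)} (hi : c i % 2 = 0) (k : ℕ) :
    sortRank 1 c true i ≤ cntBelow c true k ↔ c i < 2 * k + 2 := by
  constructor
  · intro h
    by_contra hk
    refine absurd h (not_le.2 (card_lt_card ?_))
    obtain ⟨x, hx, hxc⟩ := hc.exists_lt (show 2 * k + 1 < c i by omega)
    have hx0 : x ≠ 0 := by
      rintro rfl
      rw [hc.zero] at hxc
      omega
    rw [ssubset_iff_of_subset]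
    · refine ⟨x, ?_, ?_⟩
      · simp [SortLT]
        exact ⟨hx0, by omega, by omega⟩
      · simp
        omega
    · intro j
      simp only [mem_filter, mem_univ, true_and, SortLT, beq_iff_eq]
      rintro ⟨h1, h2, h3⟩
      exact ⟨h1, by omega, h2⟩
  · intro h
    refine card_le_card fun j => ?_
    simp only [mem_filter, mem_univ, true_and, SortLT, beq_iff_eq]
    rintro ⟨h1, h2, h3⟩
    exact ⟨h1, h3, by omega⟩

theorem sortRank_zero_false_le (hc : IsAreaFun c) {i : Fin (N + 1)} (hi : c i % 2 = 1) (k : ℕ) :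
    sortRank 0 c false i ≤ cntBelow c false (k + 1) ↔ c i < 2 * k + 2 := by
  constructor
  · intro h
    by_contra hk
    refine absurd h (not_le.2 (card_lt_card ?_))
    obtain ⟨x, hx, hxc⟩ := hc.exists_lt (show 2 * k + 2 < c i by omega)
    have hx0 : x ≠ 0 := by
      rintro rfl
      rw [hc.zero] at hxc
      omega
    rw [ssubset_iff_of_subset]
    · refine ⟨x, ?_, ?_⟩
      · simp [SortLT]
        exact ⟨hx0, by omega, by omega⟩
      · simp
        omega
    · intro j
      simp only [mem_filter, mem_univ, true_and, SortLT, beq_eq_false_iff_ne]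
      rintro ⟨h1, h2, h3⟩
      exact ⟨h1, by omega, by omega⟩
  · intro h
    refine card_le_card fun j => ?_
    simp only [mem_filter, mem_univ, true_and, SortLT, beq_eq_false_iff_ne]
    rintro ⟨h1, h2, h3⟩
    exact ⟨h1, by omega, by omega⟩

end Sorting

theorem bncP_sortPath {N : ℕ} {c : Fin (N + 1) → ℕ} {eR eG : Fin (N + 1) ≃ Fin (N + 1)}
    (hc : IsAreaFun c) (hR : IsSorting 0 c eR) (hG : IsSorting 1 c eG) (k : ℕ) :
    bncP (sortPath c eR) (sortPath c eG) k = (cntBelow c false k, cntBelow c true k) := by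
  induction k with
  | zero => simp [bncP, cntBelow]
  | succ k ih =>
    have h1 : Xval (sortPath c eG) (cntBelow c true k + 1) = cntBelow c false (k + 1) := by
      rw [Xval, cntBelow.eq_1 c false]
      simp only [hG.nBef_sortPath hc, sortPath]
      refine (hG.card_filter hc fun i =>
        (c i % 2 == 1) = false ∧ sortRank 1 c true i < cntBelow c true k + 1).trans ?_
      congr 1
      ext i
      simp only [mem_filter, mem_univ, true_and, Nat.lt_succ_iff]
      refine and_congr_right fun _ => and_congr_right fun hi => ?_
      exact sortRank_one_true_le hc (by simpa using hi) k
    have h2 : Yval (sortPath c eR) (cntBelow c false (k + 1) + 1) = cntBelow c true (k + 1) := by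
      rw [Yval, cntBelow.eq_1 c true]
      simp only [hR.eBef_sortPath hc, sortPath]
      refine (hR.card_filter hc fun i =>
        (c i % 2 == 1) = true ∧ sortRank 0 c false i < cntBelow c false (k + 1) + 1).trans ?_
      congr 1
      ext i
      simp only [mem_filter, mem_univ, true_and, Nat.lt_succ_iff]
      refine and_congr_right fun _ => and_congr_right fun hi => ?_
      exact sortRank_zero_false_le hc (by simpa using hi) k
    simp only [bncP, ih, h1, h2]

theorem card_filter_cntBelow_le {N s : ℕ} {c : Fin (N + 1) → ℕ} (hc : IsAreaFun c)
    {i : Fin (N + 1)} {b : Bool} (hi : i ≠ 0) (hb : (c i % 2 == 1) = b) :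
    #{k ∈ Icc 1 N | cntBelow c b k ≤ sortRank s c b i} = c i / 2 := by
  have h : {k ∈ Icc 1 N | cntBelow c b k ≤ sortRank s c b i} = Icc 1 (c i / 2) := by
    ext k
    rw [mem_filter, cntBelow_le_sortRank hi hb, mem_Icc, mem_Icc]
    have := hc.le i
    have := i.2
    omega
  rw [h, Nat.card_Icc, Nat.add_sub_cancel]

theorem sum_range_filter_notMem_image {L n : ℕ} (w : Fin L → Bool) (b : Bool)
    (hn : #{l | w l = b} = n) (T : Finset (Fin L)) (hT : ∀ k ∈ T, w k = b) (f : ℕ → ℕ)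
    (r : Fin L → ℕ) (hr : ∀ k, r k = #{l : Fin L | l.1 < k.1 ∧ w l = b}) :
    ∑ y ∈ (range n).filter (fun y => y ∉ T.image r), f y =
      ∑ k with w k = b ∧ k ∉ T, f (r k) := by
  have hlt : ∀ k l, w k = b → k < l → r k < r l := by
    intro k l hk hkl
    rw [hr, hr]
    refine card_lt_card ((ssubset_iff_of_subset ?_).2 ⟨k, ?_, ?_⟩)
    · intro i
      simp only [mem_filter, mem_univ, true_and]
      exact fun h => ⟨h.1.trans hkl, h.2⟩
    · simpa using ⟨hkl, hk⟩
    · simp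
  have hinj : ∀ k l, w k = b → w l = b → r k = r l → k = l := by
    intro k l hk hl h
    rcases lt_trichotomy k l with h' | h' | h'
    · exact absurd h (hlt k l hk h').ne
    · exact h'
    · exact absurd h (hlt l k hl h').ne'
  have himg : (univ.filter fun k => w k = b).image r = range n := by
    refine eq_of_subset_of_card_le ?_ ?_
    · intro y hy
      obtain ⟨k, hk, rfl⟩ := mem_image.1 hy
      rw [mem_range, hr, ← hn]
      refine card_lt_card ((ssubset_iff_of_subset ?_).2 ⟨k, hk, ?_⟩)
      · intro i
        simp only [mem_filter, mem_univ, true_and]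
        exact fun h => h.2
      · simp
    · rw [card_range, card_image_of_injOn, hn]
      intro k hk l hl h
      exact hinj k l (by simpa using hk) (by simpa using hl) h
  symm
  refine Finset.sum_bij (fun k _ => r k) ?_ ?_ ?_ ?_
  · intro k hk
    simp only [mem_filter, mem_univ, true_and] at hk
    rw [mem_filter, ← himg]
    refine ⟨mem_image_of_mem _ (by simpa using hk.1), fun h => hk.2 ?_⟩
    obtain ⟨l, hl, h⟩ := mem_image.1 h
    rwa [← hinj l k (hT l hl) hk.1 h]
  · intro k hk l hl h
    simp only [mem_filter, mem_univ, true_and] at hk hl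
    exact hinj k l hk.1 hl.1 h
  · intro y hy
    rw [mem_filter, ← himg] at hy
    obtain ⟨k, hk, rfl⟩ := mem_image.1 hy.1
    simp only [mem_filter, mem_univ, true_and] at hk
    exact ⟨k, by simpa using ⟨hk, fun h => hy.2 (mem_image_of_mem _ h)⟩, rfl⟩
  · intros
    rfl

/-- The conditions on the area word of an `m × n` reduced polyomino. -/
structure IsPolyominoFun (m n : ℕ) (c : Fin (m + n + 1) → ℕ) : Prop extends IsAreaFun c where
  card_even : #{i | c i % 2 = 0} = m + 1
  card_odd : #{i | c i % 2 = 1} = n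

section Polyomino

variable {m n : ℕ} {c : Fin (m + n + 1) → ℕ} {eR eG : Fin (m + n + 1) ≃ Fin (m + n + 1)}

theorem IsPolyominoFun.card_true {s : ℕ} {e} (hc : IsPolyominoFun m n c) (he : IsSorting s c e) :
    #{k | sortPath c e k = true} = n := by
  refine (he.card_filter hc.toIsAreaFun fun i => (c i % 2 == 1) = true).trans ?_
  refine Eq.trans (congrArg card ?_) hc.card_odd
  ext i
  simp only [mem_filter, mem_univ, true_and, beq_iff_eq, and_iff_right_iff_imp]
  rintro h rfl
  simp [hc.zero] at h

theorem IsPolyominoFun.card_false {s : ℕ} {e} (hc : IsPolyominoFun m n c)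
    (he : IsSorting s c e) : #{k | sortPath c e k = false} = m := by
  refine (he.card_filter hc.toIsAreaFun fun i => (c i % 2 == 1) = false).trans ?_
  refine Eq.trans (congrArg card ?_) ((card_erase_of_mem (a := 0) (by simp [hc.zero])).trans
    ((congrArg (· - 1) hc.card_even).trans (Nat.add_sub_cancel m 1)))
  ext i
  simp

theorem bounceRPo_sortPath (hc : IsPolyominoFun m n c) (hR : IsSorting 0 c eR)
    (hG : IsSorting 1 c eG) (S T : Finset (Fin (m + n + 1))) (hS : ∀ i ∈ S, c i % 2 = 0)
    (hT : ∀ i ∈ T, c i % 2 = 1) :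
    bounceRPo (sortPath c eR, sortPath c eG, univ.filter fun k => eG k.succ ∈ S,
        univ.filter fun k => eR k.succ ∈ T) =
      ∑ i with i ∉ S ∧ i ∉ T, c i / 2 := by
  have ha := hc.toIsAreaFun
  have h1 : ∀ k, sortPath c eR k = true →
      vLabel (sortPath c eR) (sortPath c eG) (nBef (sortPath c eR) k.1) = c (eR k.succ) / 2 := by
    intro k hk
    simp only [vLabel, bncP_sortPath ha hR hG, hR.nBef_sortPath ha]
    exact card_filter_cntBelow_le ha (hR.apply_succ_ne_zero ha k) hk
  have h2 : ∀ k, sortPath c eG k = false →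
      hLabel (sortPath c eR) (sortPath c eG) (eBef (sortPath c eG) k.1) = c (eG k.succ) / 2 := by
    intro k hk
    simp only [hLabel, bncP_sortPath ha hR hG, hG.eBef_sortPath ha]
    exact card_filter_cntBelow_le ha (hG.apply_succ_ne_zero ha k) hk
  have h3 := (sum_range_filter_notMem_image _ true (hc.card_true hR)
    (univ.filter fun k => eR k.succ ∈ T)
    (fun k hk => by simpa [sortPath] using hT _ (mem_filter.1 hk).2)
    (vLabel (sortPath c eR) (sortPath c eG)) (fun k => nBef (sortPath c eR) k.1) fun _ => rfl).trans
    (sum_congr rfl fun k hk => h1 k (mem_filter.1 hk).2.1)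
  have h4 := (sum_range_filter_notMem_image _ false (hc.card_false hG)
    (univ.filter fun k => eG k.succ ∈ S)
    (fun k hk => by simpa [sortPath] using hS _ (mem_filter.1 hk).2)
    (hLabel (sortPath c eR) (sortPath c eG)) (fun k => eBef (sortPath c eG) k.1) fun _ => rfl).trans
    (sum_congr rfl fun k hk => h2 k (mem_filter.1 hk).2.1)
  simp only [mem_filter, mem_univ, true_and] at h3 h4
  refine (congrArg₂ (· + ·)
    (h3.trans (hR.sum_filter ha (fun i => (c i % 2 == 1) = true ∧ i ∉ T) fun i => c i / 2))
    (h4.trans (hG.sum_filter ha (fun i => (c i % 2 == 1) = false ∧ i ∉ S) fun i => c i / 2))).trans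
    ?_
  simp only [sum_filter, ← sum_add_distrib, beq_iff_eq, beq_eq_false_iff_ne]
  refine sum_congr rfl fun i _ => ?_
  rcases eq_or_ne i 0 with rfl | hi
  · simp [hc.zero]
  · have hi1 := hS i
    have hi2 := hT i
    by_cases h3 : i ∈ S <;> by_cases h4 : i ∈ T <;>
      rcases Nat.mod_two_eq_zero_or_one (c i) with h | h <;> simp_all

end Polyomino

section Area

variable {N s : ℕ} {c : Fin (N + 1) → ℕ} {e : Fin (N + 1) ≃ Fin (N + 1)}

theorem sortRank_le_sortRank {b : Bool} {i j : Fin (N + 1)} (hij : i ≠ j) (hj : j ≠ 0)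
    (hb : (c j % 2 == 1) = b) : sortRank s c b i ≤ sortRank s c b j ↔ SortLT s c i j := by
  constructor
  · intro h
    by_contra hlt
    have hji : SortLT s c j i := by
      unfold SortLT at *
      omega
    refine absurd h (not_le.2 (card_lt_card ((ssubset_iff_of_subset ?_).2 ⟨j, ?_, ?_⟩)))
    · intro l
      simp only [mem_filter, mem_univ, true_and]
      refine fun ⟨h1, h2, h3⟩ => ⟨h1, ?_, h3⟩
      unfold SortLT at *
      omega
    · rw [mem_filter]
      exact ⟨mem_univ _, hj, hji, hb⟩
    · rw [mem_filter]
      exact fun h => h.2.2.1.asymm h.2.2.1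
  · intro h
    refine card_le_card fun l => ?_
    simp only [mem_filter, mem_univ, true_and]
    refine fun ⟨h1, h2, h3⟩ => ⟨h1, ?_, h3⟩
    unfold SortLT at *
    omega

theorem IsSorting.Yval_sortPath (hc : IsAreaFun c) (he : IsSorting s c e) {j : Fin (N + 1)}
    (hj : j ≠ 0) (hb : (c j % 2 == 1) = false) :
    Yval (sortPath c e) (sortRank s c false j + 1) = sortRank s c true j := by
  rw [Yval, sortRank.eq_1 s c true]
  simp only [he.eBef_sortPath hc, sortPath]
  refine (he.card_filter hc fun i =>
    (c i % 2 == 1) = true ∧ sortRank s c false i < sortRank s c false j + 1).trans ?_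
  congr 1
  ext i
  rw [mem_filter, mem_filter, and_comm (a := SortLT s c i j)]
  refine and_congr_right fun _ => and_congr_right fun _ => and_congr_right fun hi => ?_
  rw [Nat.lt_succ_iff]
  refine sortRank_le_sortRank ?_ hj hb
  rintro rfl
  simp [hi] at hb

theorem sortRank_zero_false {j : Fin (N + 1)} (hj : c j % 2 = 0) :
    sortRank 0 c false j = sortRank 1 c false j := by
  unfold sortRank
  congr 1
  ext i
  rw [mem_filter, mem_filter, and_congr_right_iff, and_congr_right_iff, and_congr_left_iff]
  intro _ _ hi
  have : c i % 2 = 0 := by simpa using hi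
  unfold SortLT
  omega

theorem sortRank_zero_true (hc : IsAreaFun c) {j : Fin (N + 1)} (hj : c j % 2 = 0) :
    sortRank 0 c true j = sortRank 1 c true j +
      ∑ i, ((if i < j ∧ c i = c j + 1 then 1 else 0) +
        if j < i ∧ c j = c i + 1 then 1 else 0) := by
  rw [sortRank, sortRank, Finset.card_filter, Finset.card_filter, ← sum_add_distrib]
  refine sum_congr rfl fun i _ => ?_
  rcases eq_or_ne i 0 with rfl | hi
  · simp [hc.zero]
  · have hij : i.1 = j.1 → c i = c j := fun h => by rw [Fin.ext h]
    unfold SortLT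
    simp only [beq_iff_eq, ne_eq, hi, not_false_eq_true, true_and]
    split_ifs <;> omega

theorem sum_even_eq_card :
    ∑ j with c j % 2 = 0, ∑ i, ((if i < j ∧ c i = c j + 1 then 1 else 0) +
        if j < i ∧ c j = c i + 1 then 1 else 0) =
      #{p : Fin (N + 1) × Fin (N + 1) | p.1 < p.2 ∧ c p.1 = c p.2 + 1} := by
  rw [Finset.card_filter, Fintype.sum_prod_type, sum_filter]
  have h1 : ∀ j, (if c j % 2 = 0 then ∑ i, ((if i < j ∧ c i = c j + 1 then 1 else 0) +
        if j < i ∧ c j = c i + 1 then 1 else 0) else 0) =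
      ∑ i, (if c i % 2 = 1 ∧ i < j ∧ c i = c j + 1 then 1 else 0) +
        ∑ i, if c j % 2 = 0 ∧ j < i ∧ c j = c i + 1 then 1 else 0 := by
    intro j
    rw [← sum_add_distrib]
    split_ifs with hj
    · refine sum_congr rfl fun i _ => ?_
      split_ifs <;> omega
    · symm
      refine sum_eq_zero fun i _ => ?_
      split_ifs <;> omega
  rw [sum_congr rfl fun j _ => h1 j, sum_add_distrib, sum_comm, ← sum_add_distrib]
  refine sum_congr rfl fun i _ => ?_
  rw [← sum_add_distrib]
  refine sum_congr rfl fun j _ => ?_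
  dsimp only
  split_ifs <;> omega

theorem card_symm_lt (e : Fin N ≃ Fin N) (k : ℕ) :
    #{i | (e.symm i).1 < k} = #{i : Fin N | i.1 < k} :=
  Finset.card_equiv e.symm (by simp)

theorem IsSorting.nBef_sortPath_eq_card (hc : IsAreaFun c) (he : IsSorting s c e) (k : ℕ) :
    nBef (sortPath c e) k = #{i | (e.symm i).1 < k + 1 ∧ c i % 2 = 1} := by
  have h := he.card_filter hc fun i => (e.symm i).1 < k + 1 ∧ c i % 2 = 1
  simp only [Equiv.symm_apply_apply, Fin.val_succ, Nat.add_lt_add_iff_right] at h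
  unfold nBef
  simp only [sortPath, beq_iff_eq]
  rw [h]
  congr 1
  ext i
  rw [mem_filter, mem_filter]
  refine and_congr_right fun _ => and_iff_right_of_imp ?_
  rintro h rfl
  simp [hc.zero] at h

theorem nBef_sortPath_le {eR eG : Fin (N + 1) ≃ Fin (N + 1)} (hc : IsAreaFun c)
    (hR : IsSorting 0 c eR) (hG : IsSorting 1 c eG) (k : ℕ) :
    nBef (sortPath c eG) k ≤ nBef (sortPath c eR) k := by
  rw [hG.nBef_sortPath_eq_card hc, hR.nBef_sortPath_eq_card hc]
  by_contra! h
  obtain ⟨i, hi, hi'⟩ := exists_mem_notMem_of_card_lt_card h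
  have key : ∀ e : Fin (N + 1) ≃ Fin (N + 1), #{i | (e.symm i).1 < k + 1 ∧ c i % 2 = 1} +
      #{i | (e.symm i).1 < k + 1 ∧ ¬ c i % 2 = 1} = #{i : Fin (N + 1) | i.1 < k + 1} := by
    intro e
    rw [← card_symm_lt e, ← filter_filter, ← filter_filter, card_filter_add_card_filter_not]
  have h' : #{i | (eG.symm i).1 < k + 1 ∧ ¬ c i % 2 = 1} <
      #{i | (eR.symm i).1 < k + 1 ∧ ¬ c i % 2 = 1} := by
    have := key eR
    have := key eG
    omega
  obtain ⟨j, hj, hj'⟩ := exists_mem_notMem_of_card_lt_card h'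
  simp only [mem_filter, mem_univ, true_and, not_and, not_not] at hi hi' hj hj'
  have h1 := (hG (eG.symm i) (eG.symm j)).1 (Fin.lt_def.2 (by omega))
  have h2 := (hR (eR.symm j) (eR.symm i)).1 (Fin.lt_def.2 (by omega))
  simp only [Equiv.apply_symm_apply] at h1 h2
  unfold SortLT at h1 h2
  omega

end Area

section Polyomino

variable {m n : ℕ} {c : Fin (m + n + 1) → ℕ} {eR eG : Fin (m + n + 1) ≃ Fin (m + n + 1)}

theorem areaRPo_sortPath (hc : IsPolyominoFun m n c) (hR : IsSorting 0 c eR)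
    (hG : IsSorting 1 c eG) (S T : Finset (Fin (m + n))) :
    areaRPo (sortPath c eR, sortPath c eG, S, T) =
      #{p : Fin (m + n + 1) × Fin (m + n + 1) | p.1 < p.2 ∧ c p.1 = c p.2 + 1} := by
  have ha := hc.toIsAreaFun
  have h1 : areaRPo (sortPath c eR, sortPath c eG, S, T) = ∑ y ∈ range m,
      (Yval (sortPath c eR) (y + 1) - Yval (sortPath c eG) (y + 1)) := by
    unfold areaRPo
    rw [range_eq_Ico, sum_Ico_add' fun y => Yval (sortPath c eR) y - Yval (sortPath c eG) y]
    refine sum_congr ?_ fun _ _ => rfl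
    ext y
    rw [mem_Icc, mem_Ico]
    omega
  have h2 := sum_range_filter_notMem_image _ false (hc.card_false hG) ∅ (by simp)
    (fun y => Yval (sortPath c eR) (y + 1) - Yval (sortPath c eG) (y + 1))
    (fun k => eBef (sortPath c eG) k.1) fun _ => rfl
  simp only [image_empty, notMem_empty, not_false_eq_true, and_true, filter_true,
    hG.eBef_sortPath ha] at h2
  rw [h1, h2, ← sum_even_eq_card]
  refine (hG.sum_filter ha (fun i => (c i % 2 == 1) = false) fun i =>
    Yval (sortPath c eR) (sortRank 1 c false i + 1) -
      Yval (sortPath c eG) (sortRank 1 c false i + 1)).trans ?_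
  rw [sum_filter, sum_filter]
  refine sum_congr rfl fun j _ => ?_
  rcases eq_or_ne j 0 with rfl | hj
  · simp [hc.zero]
  · by_cases h : c j % 2 = 0
    · have hb : (c j % 2 == 1) = false := by simp [h]
      rw [if_pos ⟨hj, hb⟩, if_pos h, hG.Yval_sortPath ha hj hb, ← sortRank_zero_false h,
        hR.Yval_sortPath ha hj hb, sortRank_zero_true ha h, Nat.add_sub_cancel_left]
    · rw [if_neg h, if_neg]
      simp [h]

theorem isRPPair_sortPath (hc : IsPolyominoFun m n c) (hR : IsSorting 0 c eR)
    (hG : IsSorting 1 c eG) : IsRPPair m n (sortPath c eR) (sortPath c eG) := by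
  refine ⟨?_, ?_, fun k _ => nBef_sortPath_le hc.toIsAreaFun hR hG k⟩
  · simpa [nBef] using hc.card_true hR
  · simpa [nBef] using hc.card_true hG

end Polyomino

section Decorations

variable {N s : ℕ} {c : Fin (N + 1) → ℕ} {e : Fin (N + 1) ≃ Fin (N + 1)}

/-- An upper letter of its sorting class comes right after a lower one in the sorted order exactly
when it is the successor of the letter immediately to its left in the word. -/
theorem IsSorting.castSucc_parity_iff (hc : IsAreaFun c) (he : IsSorting s c e) (hs : s ≤ 1)
    {k : Fin N} (hk : (c (e k.succ) + s) % 2 = 1) :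
    (c (e k.castSucc) + s) % 2 = 0 ↔
      ∃ j : Fin (N + 1), (e k.succ).1 = j.1 + 1 ∧ c (e k.succ) = c j + 1 := by
  have hpi : SortLT s c (e k.castSucc) (e k.succ) := (he _ _).1 Fin.castSucc_lt_succ
  have hbetween : ∀ x, SortLT s c (e k.castSucc) x → ¬ SortLT s c x (e k.succ) := by
    intro x h1 h2
    obtain ⟨a, rfl⟩ := e.surjective x
    have h3 := Fin.lt_def.1 ((he _ _).2 h1)
    have h4 := Fin.lt_def.1 ((he _ _).2 h2)
    simp only [Fin.val_castSucc, Fin.val_succ] at h3 h4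
    omega
  generalize e k.succ = i at *
  generalize e k.castSucc = p at *
  have hcongr : ∀ x y : Fin (N + 1), x.1 = y.1 → c x = c y := fun x y h => by rw [Fin.ext h]
  constructor
  · intro hp
    have hi1 : 1 ≤ c i := by
      unfold SortLT at hpi
      omega
    obtain ⟨x, hx, hxc⟩ := hc.exists_lt (show c i - 1 < c i by omega)
    have hpx := mt (hbetween x)
    have hcp : c p + 1 = c i ∧ p < i := by
      have := hcongr x p
      unfold SortLT at *
      omega
    by_cases hpq : p.1 + 1 = i.1
    · exact ⟨p, hpq.symm, hcp.1.symm⟩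
    · exfalso
      have hlt := Fin.lt_def.1 hcp.2
      have hiN := i.2
      let q : Fin (N + 1) := ⟨i.1 - 1, by omega⟩
      let r : Fin (N + 1) := ⟨p.1 + 1, by omega⟩
      have hqv : q.1 = i.1 - 1 := rfl
      have hrv : r.1 = p.1 + 1 := rfl
      have h1 := hc.step q i (by omega)
      have h2 := hc.step p r rfl
      have h3 := hbetween q
      have h4 := hbetween r
      have hq : c i < c q := by
        unfold SortLT at *
        omega
      have hr : c r < c i := by
        unfold SortLT at *
        omega
      obtain ⟨y, hy1, hy2, hy3⟩ := hc.exists_eq (a := r) (b := q)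
        (Fin.le_def.2 (by omega)) hr.le hq.le
      refine hbetween y ?_ ?_
      · unfold SortLT
        omega
      · unfold SortLT
        omega
  · rintro ⟨j, hj, hcj⟩
    have h1 := hbetween j
    have h2 := hcongr p j
    unfold SortLT at *
    omega

theorem isRedValley_sortPath (hc : IsAreaFun c) (he : IsSorting 0 c e) (k : Fin N) :
    IsRedValley (sortPath c e) k ↔ c (e k.succ) % 2 = 1 ∧
      ∃ j : Fin (N + 1), (e k.succ).1 = j.1 + 1 ∧ c (e k.succ) = c j + 1 := by
  unfold IsRedValley
  rw [sortPath, beq_iff_eq]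
  refine and_congr_right fun hk => ?_
  rw [← he.castSucc_parity_iff hc zero_le_one hk]
  constructor
  · rintro (h | ⟨l, hl, h⟩)
    · rw [show k.castSucc = 0 from Fin.ext h, he.apply_zero hc, hc.zero]
    · rw [show k.castSucc = l.succ from Fin.ext hl]
      simpa [sortPath] using h
  · intro h
    refine or_iff_not_imp_left.2 fun h0 => ⟨⟨k.1 - 1, by omega⟩, by dsimp only; omega, ?_⟩
    rw [sortPath, show Fin.succ _ = k.castSucc from Fin.ext (by simp; omega)]
    simpa using h

theorem isGreenPeak_sortPath (hc : IsAreaFun c) (he : IsSorting 1 c e) (k : Fin N) :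
    IsGreenPeak (sortPath c e) k ↔ c (e k.succ) % 2 = 0 ∧
      ∃ j : Fin (N + 1), (e k.succ).1 = j.1 + 1 ∧ c (e k.succ) = c j + 1 := by
  unfold IsGreenPeak
  rw [sortPath, beq_eq_false_iff_ne, Nat.mod_two_ne_one]
  refine and_congr_right fun hk => ?_
  rw [← he.castSucc_parity_iff hc le_rfl (by omega)]
  constructor
  · rintro ⟨l, hl, h⟩
    rw [show k.castSucc = l.succ from Fin.ext hl]
    simp only [sortPath, beq_iff_eq] at h
    omega
  · intro h
    have h0 : k.1 ≠ 0 := by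
      intro h0
      rw [show k.castSucc = 0 from Fin.ext h0, he.apply_zero hc, hc.zero] at h
      omega
    refine ⟨⟨k.1 - 1, by omega⟩, by dsimp only; omega, ?_⟩
    rw [sortPath, show Fin.succ _ = k.castSucc from Fin.ext (by simp; omega), beq_iff_eq]
    omega

theorem IsSorting.card_filter_mem (hc : IsAreaFun c) (he : IsSorting s c e)
    {D : Finset (Fin (N + 1))} (hD : (0 : Fin (N + 1)) ∉ D) :
    #{k : Fin N | e k.succ ∈ D} = #D := by
  refine (he.card_filter hc fun i => i ∈ D).trans (congrArg card ?_)
  ext i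
  rw [mem_filter]
  refine ⟨fun h => h.2.2, fun h => ⟨mem_univ _, ?_, h⟩⟩
  rintro rfl
  exact hD h

end Decorations

theorem IsAreaFun.exists_isSorting {N s K : ℕ} {c : Fin (N + 1) → ℕ} (hc : IsAreaFun c)
    (hs : s ≤ 1) (hK : ∀ i, c i < K) :
    ∃ e, IsSorting s c e ∧ sortBits s K (List.ofFn c) = false :: List.ofFn (sortPath c e) := by
  obtain ⟨e, he, h⟩ := _root_.exists_isSorting s K c fun i => by
    have := hK i
    omega
  refine ⟨e, he, ?_⟩
  rw [h, List.ofFn_succ, he.apply_zero hc, hc.zero]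
  rfl

theorem isAreaWord_ofFn {N : ℕ} {c : Fin (N + 1) → ℕ} :
    IsAreaWord (List.ofFn c) ↔ IsAreaFun c := by
  unfold IsAreaWord
  rw [List.isChain_iff_getElem]
  constructor
  · rintro ⟨h1, h2⟩
    refine ⟨h1 _ (by simp), fun i j hij => ?_⟩
    have := h2 i.1 (by simp; omega)
    simp only [List.getElem_ofFn] at this
    convert this using 2
    exact Fin.ext hij
  · rintro ⟨h1, h2⟩
    refine ⟨by simpa using h1, fun i hi => ?_⟩
    simp only [List.getElem_ofFn]
    exact h2 _ _ rfl

theorem nBef_eq_count {L : ℕ} (w : Fin L → Bool) (k : ℕ) :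
    nBef w k = ((List.ofFn w).take k).count true := by
  unfold nBef
  rw [Finset.card_filter]
  induction L generalizing k with
  | zero => simp
  | succ L ih =>
    cases k with
    | zero => simp
    | succ k =>
      rw [Fin.sum_univ_succ, List.ofFn_succ, List.take_succ_cons, List.count_cons, ← ih]
      simp [add_comm]

theorem nBef_eq_self {L k : ℕ} (w : Fin L → Bool) (hk : L ≤ k) :
    nBef w k = #{i | w i = true} := by
  unfold nBef
  congr 1
  ext i
  rw [mem_filter, mem_filter]
  exact and_congr_right fun _ => and_iff_right (i.2.trans_le hk)

theorem IsRPWord.isPolyominoFun {m n : ℕ} {c : Fin (m + n + 1) → Fin (2 * (m + n + 1))}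
    (h : IsRPWord m n c) : IsPolyominoFun m n fun i => (c i : ℕ) where
  zero := h.1 0 rfl
  step := h.2.1
  card_even := h.2.2.1
  card_odd := h.2.2.2

theorem IsPolyominoFun.of_card_true {m n : ℕ} {c : Fin (m + n + 1) → ℕ} {s : ℕ} {e}
    (hc : IsAreaFun c) (he : IsSorting s c e) (h : #{k | sortPath c e k = true} = n) :
    IsPolyominoFun m n c := by
  have hodd : #{i | c i % 2 = 1} = n := by
    refine Eq.trans (congrArg card ?_)
      ((he.card_filter hc fun i => (c i % 2 == 1) = true).symm.trans h)
    ext i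
    rw [mem_filter, mem_filter, beq_iff_eq]
    refine and_congr_right fun _ => (and_iff_right_of_imp ?_).symm
    rintro h rfl
    simp [hc.zero] at h
  refine ⟨hc, ?_, hodd⟩
  have h1 := card_filter_add_card_filter_not (s := univ) fun i => c i % 2 = 1
  simp only [Nat.mod_two_ne_one, card_univ, Fintype.card_fin] at h1
  omega

/-- Every pair of paths bounding a reduced polyomino is read off an area word. -/
theorem IsRPPair.exists_areaFun {m n : ℕ} {red green : Fin (m + n) → Bool}
    (h : IsRPPair m n red green) :
    ∃ c : Fin (m + n + 1) → ℕ, IsAreaFun c ∧ ∀ K, (∀ i, c i < K) →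
      sortBits 0 K (List.ofFn c) = false :: List.ofFn red ∧
      sortBits 1 K (List.ofFn c) = false :: List.ofFn green := by
  obtain ⟨h1, h2, h3⟩ := h
  have hcount : ∀ w : Fin (m + n) → Bool, (List.ofFn w).count true = nBef w (m + n) := by
    intro w
    rw [nBef_eq_count, List.take_of_length_le (by simp)]
  have habove (k : ℕ) : ((false :: List.ofFn green).take k).count true ≤
      ((false :: List.ofFn red).take k).count true := by
    cases k with
    | zero => simp
    | succ k =>
      simp only [List.take_succ_cons, List.count_cons, ← nBef_eq_count]
      rcases le_or_gt k (m + n) with hk | hk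
      · simpa using h3 k hk
      · have h4 := h3 (m + n) le_rfl
        rw [nBef_eq_self _ le_rfl, nBef_eq_self _ le_rfl] at h4
        simpa [nBef_eq_self _ hk.le] using h4
  obtain ⟨w, hw, hlen, hsort⟩ := exists_areaWord (false :: List.ofFn red) (false :: List.ofFn green)
    (by simp) (by simp [hcount, h1, h2]) habove rfl rfl
  replace hlen : w.length = m + n + 1 := by simpa using hlen
  have hofFn : List.ofFn (fun i : Fin (m + n + 1) => w[i.1]'(by omega)) = w := by
    apply List.ext_getElem
    · simp [hlen]
    · intros
      rw [List.getElem_ofFn]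
  refine ⟨fun i => w[i.1]'(by omega), ?_, fun K hK => ?_⟩
  · rwa [← isAreaWord_ofFn, hofFn]
  · rw [hofFn]
    refine hsort K fun x hx => ?_
    obtain ⟨i, hi, rfl⟩ := List.getElem_of_mem hx
    exact hK ⟨i, by omega⟩

theorem eq_of_forall_apply_succ_mem_iff {N s : ℕ} {c : Fin (N + 1) → ℕ}
    {e : Fin (N + 1) ≃ Fin (N + 1)} (hc : IsAreaFun c) (he : IsSorting s c e)
    {D D' : Finset (Fin (N + 1))} (hD : (0 : Fin (N + 1)) ∉ D) (hD' : (0 : Fin (N + 1)) ∉ D')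
    (h : ∀ k : Fin N, e k.succ ∈ D ↔ e k.succ ∈ D') : D = D' := by
  ext i
  rcases eq_or_ne i 0 with rfl | hi
  · exact iff_of_false hD hD'
  · obtain ⟨k, rfl⟩ := he.exists_apply_succ hc hi
    exact h k

/-- For all `m, n, k, j ≥ 0`,
`RP_{q,t}(m,n)^{∗k,j} = RP_{q,t}(m,n)^{∘k,j}`: the `(dinv, area)` enumerator of
doubly decorated reduced polyominoes equals the `(area, bounce)` enumerator. -/
theorem RPstar_eq_RPo (m n k j : ℕ) :
    ∑ x ∈ univ.filter (IsRPstarAll m n k j), qv ^ dinvRPstar x * tv ^ areaRPstar x =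
      ∑ y ∈ univ.filter (IsRPoAll m n k j), qv ^ areaRPo y * tv ^ bounceRPo y := by
  have hlt : ∀ (c : Fin (m + n + 1) → Fin (2 * (m + n + 1))) i, (c i : ℕ) < 2 * (m + n + 1) :=
    fun c i => (c i).2
  choose! eR hR hR' using fun (c : Fin (m + n + 1) → Fin (2 * (m + n + 1)))
    (hc : IsAreaFun fun i => (c i : ℕ)) => hc.exists_isSorting zero_le_one (hlt c)
  choose! eG hG hG' using fun (c : Fin (m + n + 1) → Fin (2 * (m + n + 1)))
    (hc : IsAreaFun fun i => (c i : ℕ)) => hc.exists_isSorting le_rfl (hlt c)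
  have hS0 : ∀ (c : Fin (m + n + 1) → Fin (2 * (m + n + 1))) (S : Finset (Fin (m + n + 1))),
      (∀ i ∈ S, IsUnbarredRise c i) → (0 : Fin (m + n + 1)) ∉ S := by
    intro c S h h0
    obtain ⟨-, j, hj, -⟩ := h 0 h0
    simp at hj
  have hT0 : ∀ (c : Fin (m + n + 1) → Fin (2 * (m + n + 1))) (S : Finset (Fin (m + n + 1))),
      (∀ i ∈ S, IsBarredRise c i) → (0 : Fin (m + n + 1)) ∉ S := by
    intro c S h h0
    obtain ⟨-, j, hj, -⟩ := h 0 h0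
    simp at hj
  refine Finset.sum_bij (fun x _ => (sortPath (fun i => (x.1 i : ℕ)) (eR x.1),
    sortPath (fun i => (x.1 i : ℕ)) (eG x.1), univ.filter fun k => eG x.1 k.succ ∈ x.2.1,
    univ.filter fun k => eR x.1 k.succ ∈ x.2.2)) ?_ ?_ ?_ ?_
  · rintro ⟨c, S, T⟩ hx
    obtain ⟨hc, hS, rfl, hT, rfl⟩ := (mem_filter.1 hx).2
    have hp := hc.isPolyominoFun
    have ha := hp.toIsAreaFun
    rw [mem_filter]
    refine ⟨mem_univ _, isRPPair_sortPath hp (hR c ha) (hG c ha), fun k hk => ?_,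
      (hG c ha).card_filter_mem ha (hS0 c S hS), fun k hk => ?_,
      (hR c ha).card_filter_mem ha (hT0 c T hT)⟩
    · exact (isGreenPeak_sortPath ha (hG c ha) k).2 (hS _ (mem_filter.1 hk).2)
    · exact (isRedValley_sortPath ha (hR c ha) k).2 (hT _ (mem_filter.1 hk).2)
  · rintro ⟨c, S, T⟩ hx ⟨c', S', T'⟩ hx' h
    obtain ⟨hc, hS, -, hT, -⟩ := (mem_filter.1 hx).2
    obtain ⟨hc', hS', -, hT', -⟩ := (mem_filter.1 hx').2
    have ha := hc.isPolyominoFun.toIsAreaFun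
    have ha' := hc'.isPolyominoFun.toIsAreaFun
    simp only [Prod.mk.injEq] at h hS hT hS' hT' ha ha'
    obtain ⟨h1, h2, h3, h4⟩ := h
    have hcc : c = c' := by
      have := areaWord_ext (isAreaWord_ofFn.2 ha) (isAreaWord_ofFn.2 ha')
        (List.forall_mem_ofFn_iff.2 (hlt c)) (List.forall_mem_ofFn_iff.2 (hlt c'))
        (by rw [hR' c ha, hR' c' ha', h1]) (by rw [hG' c ha, hG' c' ha', h2])
      funext i
      exact Fin.ext (congrFun (List.ofFn_injective this) i)
    subst hcc
    rw [eq_of_forall_apply_succ_mem_iff ha (hG c ha) (hS0 c S hS) (hS0 c S' hS') fun k => by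
        simpa using congrArg (k ∈ ·) h3,
      eq_of_forall_apply_succ_mem_iff ha (hR c ha) (hT0 c T hT) (hT0 c T' hT') fun k => by
        simpa using congrArg (k ∈ ·) h4]
  · rintro ⟨red, green, S, T⟩ hy
    obtain ⟨hp, hS, rfl, hT, rfl⟩ := (mem_filter.1 hy).2
    dsimp only at hp hS hT
    obtain ⟨d, hd, hsort⟩ := hp.exists_areaFun
    let c : Fin (m + n + 1) → Fin (2 * (m + n + 1)) := fun i => ⟨d i, by
      have := hd.le i
      have := i.2
      omega⟩
    have ha : IsAreaFun fun i => (c i : ℕ) := hd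
    obtain ⟨h1, h2⟩ := hsort _ (hlt c)
    have h1' : sortPath (fun i => (c i : ℕ)) (eR c) = red :=
      List.ofFn_injective (List.cons.inj ((hR' c ha).symm.trans h1)).2
    have h2' : sortPath (fun i => (c i : ℕ)) (eG c) = green :=
      List.ofFn_injective (List.cons.inj ((hG' c ha).symm.trans h2)).2
    have hc : IsPolyominoFun m n fun i => (c i : ℕ) := by
      refine IsPolyominoFun.of_card_true ha (hR c ha) ?_
      rw [h1', ← nBef_eq_self red le_rfl]
      exact hp.1
    have hmem : ∀ (e : Fin (m + n + 1) ≃ Fin (m + n + 1)) (D : Finset (Fin (m + n))),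
        (univ.filter fun k => e k.succ ∈ D.image fun l => e l.succ) = D := by
      intro e D
      ext k
      simp
    subst h1' h2'
    have hS1 : ∀ i ∈ S.image fun k => eG c k.succ, IsUnbarredRise c i := by
      intro i hi
      obtain ⟨k, hk, rfl⟩ := mem_image.1 hi
      exact (isGreenPeak_sortPath ha (hG c ha) k).1 (hS k hk)
    have hT1 : ∀ i ∈ T.image fun k => eR c k.succ, IsBarredRise c i := by
      intro i hi
      obtain ⟨k, hk, rfl⟩ := mem_image.1 hi
      exact (isRedValley_sortPath ha (hR c ha) k).1 (hT k hk)
    refine ⟨(c, S.image fun k => eG c k.succ, T.image fun k => eR c k.succ),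
      mem_filter.2 ⟨mem_univ _, ⟨fun i hi => ?_, ha.step, hc.card_even, hc.card_odd⟩,
        hS1, ?_, hT1, ?_⟩, ?_⟩
    · rw [show i = 0 from Fin.ext hi]
      exact ha.zero
    · exact card_image_of_injective _ fun k l h => Fin.succ_injective _ ((eG c).injective h)
    · exact card_image_of_injective _ fun k l h => Fin.succ_injective _ ((eR c).injective h)
    · simp only [hmem]
  · rintro ⟨c, S, T⟩ hx
    obtain ⟨hc, hS, rfl, hT, rfl⟩ := (mem_filter.1 hx).2
    have hp := hc.isPolyominoFun
    have ha := hp.toIsAreaFun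
    rw [areaRPo_sortPath hp (hR c ha) (hG c ha), bounceRPo_sortPath hp (hR c ha) (hG c ha) S T
      (fun i hi => (hS i hi).1) fun i hi => (hT i hi).1]
    rfl
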